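/- Let ρ be a density matrix on ℂ^{dA} ⊗ ℂ^{dB} and k ≥ 2. Then max{ E_WD,1(ρ), E_WD,2(ρ) } ≤ D_M(ρ ‖ PPT_k(A:B)), where D_M(ρ‖B) := inf_{σ∈B} D_M(ρ‖σ). -/

import Mathlib

open scoped Kronecker ComplexOrder Matrix

attribute [local instance] Classical.propDecidable

noncomputable section

namespace QIT

variable {n : Type*} [Fintype n] [DecidableEq n]

/-- Base-2 matrix logarithm taken on the support (junk value `0` for non-Hermitian input). -/
def matLog (A : Matrix n n ℂ) : Matrix n n ℂ :=
  if hA : A.IsHermitian then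
    (hA.eigenvectorUnitary : Matrix n n ℂ) *
      Matrix.diagonal (fun i => if hA.eigenvalues i = 0 then (0 : ℂ)
        else (Real.logb 2 (hA.eigenvalues i) : ℂ)) *
      (hA.eigenvectorUnitary : Matrix n n ℂ)ᴴ
  else 0

/-- Orthogonal projection onto the support of a Hermitian matrix. -/
def suppProj (A : Matrix n n ℂ) : Matrix n n ℂ :=
  if hA : A.IsHermitian then
    (hA.eigenvectorUnitary : Matrix n n ℂ) *
      Matrix.diagonal (fun i => if hA.eigenvalues i = 0 then (0 : ℂ) else 1) *
      (hA.eigenvectorUnitary : Matrix n n ℂ)ᴴ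
  else 0

/-- Support inclusion `supp ρ ⊆ supp σ`, phrased via kernels. -/
def suppLE (ρ σ : Matrix n n ℂ) : Prop :=
  ∀ x : n → ℂ, σ.mulVec x = 0 → ρ.mulVec x = 0

/-- Umegaki relative entropy (base 2), `+∞` when supports are not included. -/
def relEnt (ρ σ : Matrix n n ℂ) : EReal :=
  if suppLE ρ σ then (((ρ * (matLog ρ - matLog σ)).trace).re : EReal) else ⊤

/-- Classical relative-entropy summand `p log₂(p/q)` with conventions
`0 · log(0/q) = 0` and `p · log(p/0) = +∞` for `p ≠ 0`. -/
def klTerm (p q : ℝ) : EReal :=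
  if p = 0 then 0 else if q = 0 then ⊤ else ((p * Real.logb 2 (p / q) : ℝ) : EReal)

/-- A finite POVM. -/
def IsPOVM {m : ℕ} (M : Fin m → Matrix n n ℂ) : Prop :=
  (∀ x, (M x).PosSemidef) ∧ ∑ x, M x = 1

/-- Measured relative entropy (base 2). -/
def measRelEnt (ρ σ : Matrix n n ℂ) : EReal :=
  ⨆ (m : ℕ) (M : Fin m → Matrix n n ℂ) (_ : IsPOVM M),
    ∑ x, klTerm ((M x * ρ).trace).re ((M x * σ).trace).re

/-- Trace norm: sum of singular values. -/
def traceNorm (A : Matrix n n ℂ) : ℝ :=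
  ∑ i, Real.sqrt ((Matrix.posSemidef_conjTranspose_mul_self A).1.eigenvalues i)

/-- Operator (spectral) norm: largest singular value. -/
def opNorm (A : Matrix n n ℂ) : ℝ :=
  ⨆ i, Real.sqrt ((Matrix.posSemidef_conjTranspose_mul_self A).1.eigenvalues i)

/-- Partial transpose on the second tensor factor. -/
def ptB {α β : Type*} (X : Matrix (α × β) (α × β) ℂ) : Matrix (α × β) (α × β) ℂ :=
  Matrix.of fun p q => X (p.1, q.2) (q.1, p.2)

/-- Kronecker product of two bipartite matrices, reindexed to the bipartition (A×A') : (B×B'). -/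
def kron2 {α β γ δ : Type*} (X : Matrix (α × β) (α × β) ℂ) (Y : Matrix (γ × δ) (γ × δ) ℂ) :
    Matrix ((α × γ) × β × δ) ((α × γ) × β × δ) ℂ :=
  Matrix.reindex (Equiv.prodProdProdComm α β γ δ) (Equiv.prodProdProdComm α β γ δ) (X ⊗ₖ Y)

/-- The permutation unitary on `(ℂ^d)^{⊗ m}`. -/
def permMat (d m : ℕ) (π : Equiv.Perm (Fin m)) :
    Matrix (Fin m → Fin d) (Fin m → Fin d) ℂ :=
  Matrix.of fun f g => if f ∘ π = g then 1 else 0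

/-- Membership in the `PPT_k` set. -/
def memPPTk {α β : Type*} [Fintype α] [Fintype β] [DecidableEq α] [DecidableEq β]
    (k : ℕ) (X : Matrix (α × β) (α × β) ℂ) : Prop :=
  X.PosSemidef ∧ ∃ ω : ℕ → Matrix (α × β) (α × β) ℂ,
    ω 1 = X ∧ (∀ i ∈ Finset.Icc 1 k, (ω i).IsHermitian) ∧
    (∀ i ∈ Finset.Icc 1 (k - 1),
      ((ω (i + 1)) - ptB (ω i)).PosSemidef ∧ ((ω (i + 1)) + ptB (ω i)).PosSemidef) ∧
    traceNorm (ptB (ω k)) ≤ 1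

/-- Membership in the Rains set. -/
def memRains {α β : Type*} [Fintype α] [Fintype β] [DecidableEq α] [DecidableEq β]
    (σ : Matrix (α × β) (α × β) ℂ) : Prop :=
  σ.PosSemidef ∧ traceNorm (ptB σ) ≤ 1


/-- Spectral function calculus of a Hermitian matrix: apply `f` to the eigenvalues. -/
def specFn {A : Matrix n n ℂ} (hA : A.IsHermitian) (f : ℝ → ℝ) : Matrix n n ℂ :=
  (hA.eigenvectorUnitary : Matrix n n ℂ) *
    Matrix.diagonal (fun i => (f (hA.eigenvalues i) : ℂ)) *
    (hA.eigenvectorUnitary : Matrix n n ℂ)ᴴ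

lemma conjTranspose_mul_eigenvectorUnitary {A : Matrix n n ℂ} (hA : A.IsHermitian) :
    (hA.eigenvectorUnitary : Matrix n n ℂ)ᴴ * (hA.eigenvectorUnitary : Matrix n n ℂ) = 1 :=
  Unitary.coe_star_mul_self hA.eigenvectorUnitary

lemma eigenvectorUnitary_mul_conjTranspose {A : Matrix n n ℂ} (hA : A.IsHermitian) :
    (hA.eigenvectorUnitary : Matrix n n ℂ) * (hA.eigenvectorUnitary : Matrix n n ℂ)ᴴ = 1 :=
  Unitary.coe_mul_star_self hA.eigenvectorUnitary

lemma specFn_id {A : Matrix n n ℂ} (hA : A.IsHermitian) : specFn hA (fun x => x) = A := by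
  conv_rhs => rw [hA.spectral_theorem, Unitary.conjStarAlgAut_apply]
  rfl

lemma specFn_const {A : Matrix n n ℂ} (hA : A.IsHermitian) (c : ℝ) :
    specFn hA (fun _ => c) = (c : ℂ) • (1 : Matrix n n ℂ) := by
  have h : Matrix.diagonal (fun _ : n => (c : ℂ)) = (c : ℂ) • (1 : Matrix n n ℂ) := by
    rw [Matrix.smul_one_eq_diagonal]
  rw [specFn, h, mul_smul_comm, mul_one, smul_mul_assoc, eigenvectorUnitary_mul_conjTranspose]

lemma specFn_mul {A : Matrix n n ℂ} (hA : A.IsHermitian) (f g : ℝ → ℝ) :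
    specFn hA f * specFn hA g = specFn hA (fun x => f x * g x) := by
  set U := (hA.eigenvectorUnitary : Matrix n n ℂ) with hU
  have h : specFn hA f * specFn hA g =
      U * (Matrix.diagonal (fun i => (f (hA.eigenvalues i) : ℂ)) * (Uᴴ * U) *
        Matrix.diagonal (fun i => (g (hA.eigenvalues i) : ℂ))) * Uᴴ := by
    simp only [specFn, ← hU, mul_assoc]
  rw [h, conjTranspose_mul_eigenvectorUnitary, mul_one, Matrix.diagonal_mul_diagonal, specFn]
  simp [hU]

lemma specFn_add {A : Matrix n n ℂ} (hA : A.IsHermitian) (f g : ℝ → ℝ) :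
    specFn hA f + specFn hA g = specFn hA (fun x => f x + g x) := by
  simp only [specFn, ← add_mul, ← mul_add, Matrix.diagonal_add, Complex.ofReal_add]

lemma specFn_sub {A : Matrix n n ℂ} (hA : A.IsHermitian) (f g : ℝ → ℝ) :
    specFn hA f - specFn hA g = specFn hA (fun x => f x - g x) := by
  simp only [specFn, ← sub_mul, ← mul_sub, Matrix.diagonal_sub, Complex.ofReal_sub]

lemma specFn_trace {A : Matrix n n ℂ} (hA : A.IsHermitian) (f : ℝ → ℝ) :
    (specFn hA f).trace = ((∑ i, f (hA.eigenvalues i) : ℝ) : ℂ) := by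
  rw [specFn, Matrix.trace_mul_cycle, conjTranspose_mul_eigenvectorUnitary, one_mul,
    Matrix.trace_diagonal, Complex.ofReal_sum]

lemma specFn_posSemidef {A : Matrix n n ℂ} (hA : A.IsHermitian) {f : ℝ → ℝ}
    (hf : ∀ i, 0 ≤ f (hA.eigenvalues i)) : (specFn hA f).PosSemidef := by
  refine Matrix.PosSemidef.mul_mul_conjTranspose_same (Matrix.PosSemidef.diagonal ?_) _
  intro i
  exact Complex.zero_le_real.2 (hf i)

lemma specFn_charpoly_roots {A : Matrix n n ℂ} (hA : A.IsHermitian) (f : ℝ → ℝ) :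
    (specFn hA f).charpoly.roots =
      Multiset.map (fun i => (f (hA.eigenvalues i) : ℂ)) Finset.univ.val := by
  rw [specFn, Matrix.charpoly_mul_comm, ← mul_assoc, conjTranspose_mul_eigenvectorUnitary, one_mul,
    Matrix.charpoly_diagonal, Polynomial.roots_prod]
  · simp
  · simp [Finset.prod_ne_zero_iff, Polynomial.X_sub_C_ne_zero]

/-- The singular values of a Hermitian matrix are the absolute values of its eigenvalues. -/
lemma map_singularValues_eq_map_abs {A : Matrix n n ℂ} (hA : A.IsHermitian) :
    Multiset.map (fun i => Real.sqrt
        ((Matrix.posSemidef_conjTranspose_mul_self A).1.eigenvalues i)) Finset.univ.val =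
      Multiset.map (fun i => |hA.eigenvalues i|) Finset.univ.val := by
  have hsq : Aᴴ * A = specFn hA (fun x => x * x) := by
    rw [← specFn_mul, specFn_id, hA.eq]
  have h := specFn_charpoly_roots hA (fun x => x * x)
  rw [← hsq, (Matrix.posSemidef_conjTranspose_mul_self A).1.roots_charpoly_eq_eigenvalues] at h
  have h2 := congrArg (Multiset.map (fun z : ℂ => Real.sqrt z.re)) h
  simpa [Multiset.map_map, Function.comp_def, Real.sqrt_mul_self_eq_abs] using h2

lemma traceNorm_eq_sum_abs {A : Matrix n n ℂ} (hA : A.IsHermitian) :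
    traceNorm A = ∑ i, |hA.eigenvalues i| :=
  congrArg Multiset.sum (map_singularValues_eq_map_abs hA)

lemma abs_eigenvalues_le_opNorm {A : Matrix n n ℂ} (hA : A.IsHermitian) (j : n) :
    |hA.eigenvalues j| ≤ opNorm A := by
  have hj : |hA.eigenvalues j| ∈ Multiset.map (fun i => |hA.eigenvalues i|) Finset.univ.val :=
    Multiset.mem_map.2 ⟨j, Finset.mem_univ j, rfl⟩
  rw [← map_singularValues_eq_map_abs hA] at hj
  obtain ⟨i, -, hi⟩ := Multiset.mem_map.1 hj
  rw [← hi]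
  exact le_ciSup (f := fun i => Real.sqrt
    ((Matrix.posSemidef_conjTranspose_mul_self A).1.eigenvalues i)) (Set.finite_range _).bddAbove i

lemma opNorm_nonneg (A : Matrix n n ℂ) : 0 ≤ opNorm A :=
  Real.iSup_nonneg fun _ => Real.sqrt_nonneg _

lemma trace_mul_re_nonneg {A B : Matrix n n ℂ} (hA : A.PosSemidef) (hB : B.PosSemidef) :
    0 ≤ ((A * B).trace).re := by
  have hs : specFn hA.1 Real.sqrt * specFn hA.1 Real.sqrt = A := by
    rw [specFn_mul]
    conv_rhs => rw [← specFn_id hA.1]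
    simp only [specFn]
    congr 3
    funext i
    rw [Real.mul_self_sqrt (hA.eigenvalues_nonneg i)]
  have hS := (specFn_posSemidef hA.1 (f := Real.sqrt) fun i => Real.sqrt_nonneg _).1
  have h := (hB.mul_mul_conjTranspose_same (specFn hA.1 Real.sqrt)).trace_nonneg
  rw [hS.eq, Matrix.trace_mul_cycle, hs] at h
  exact (Complex.nonneg_iff.1 h).1

/-- If `-Y ≤ A ≤ Y` and `-W ≤ B ≤ W` then `tr (A B) ≤ tr (Y W)`. -/
lemma trace_mul_re_le_of_dominated {A B Y W : Matrix n n ℂ}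
    (h₁ : (Y - A).PosSemidef) (h₂ : (Y + A).PosSemidef)
    (h₃ : (W - B).PosSemidef) (h₄ : (W + B).PosSemidef) :
    ((A * B).trace).re ≤ ((Y * W).trace).re := by
  have ha := trace_mul_re_nonneg h₁ h₄
  have hb := trace_mul_re_nonneg h₂ h₃
  simp only [sub_mul, add_mul, mul_sub, mul_add, Matrix.trace_add, Matrix.trace_sub,
    Complex.add_re, Complex.sub_re] at ha hb
  linarith

/-- If `-W ≤ A ≤ W` then `‖A‖₁ ≤ tr W`. -/
lemma traceNorm_le_trace {A W : Matrix n n ℂ} (hA : A.IsHermitian)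
    (h₁ : (W - A).PosSemidef) (h₂ : (W + A).PosSemidef) : traceNorm A ≤ (W.trace).re := by
  have hS₁ : ((1 : Matrix n n ℂ) - specFn hA (fun x => (SignType.sign x : ℝ))).PosSemidef := by
    have h := specFn_const hA 1
    rw [Complex.ofReal_one, one_smul] at h
    rw [← h, specFn_sub]
    refine specFn_posSemidef hA fun i => ?_
    rcases lt_trichotomy (hA.eigenvalues i) 0 with h | h | h <;> simp [h]
  have hS₂ : ((1 : Matrix n n ℂ) + specFn hA (fun x => (SignType.sign x : ℝ))).PosSemidef := by
    have h := specFn_const hA 1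
    rw [Complex.ofReal_one, one_smul] at h
    rw [← h, specFn_add]
    refine specFn_posSemidef hA fun i => ?_
    rcases lt_trichotomy (hA.eigenvalues i) 0 with h | h | h <;> simp [h]
  have h := trace_mul_re_le_of_dominated hS₁ hS₂ h₁ h₂
  have hSA : specFn hA (fun x => (SignType.sign x : ℝ)) * A = specFn hA (fun x => |x|) := by
    nth_rw 2 [← specFn_id hA]
    simp only [specFn_mul, sign_mul_self]
  rw [hSA, specFn_trace, Complex.ofReal_re, one_mul] at h
  rwa [traceNorm_eq_sum_abs hA]

/-- Hölder's inequality between the operator norm and the trace norm. -/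
lemma trace_mul_re_le_opNorm_mul_traceNorm {A B : Matrix n n ℂ} (hA : A.IsHermitian)
    (hB : B.IsHermitian) : ((A * B).trace).re ≤ opNorm A * traceNorm B := by
  have h₁ : ((opNorm A : ℂ) • (1 : Matrix n n ℂ) - A).PosSemidef := by
    have := specFn_posSemidef hA (f := fun x => opNorm A - x)
      fun i => sub_nonneg.2 ((le_abs_self _).trans (abs_eigenvalues_le_opNorm hA i))
    rwa [← specFn_sub, specFn_const, specFn_id] at this
  have h₂ : ((opNorm A : ℂ) • (1 : Matrix n n ℂ) + A).PosSemidef := by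
    have := specFn_posSemidef hA (f := fun x => opNorm A + x)
      fun i => by linarith [(neg_abs_le _).trans' (neg_le_neg (abs_eigenvalues_le_opNorm hA i))]
    rwa [← specFn_add, specFn_const, specFn_id] at this
  have h₃ : (specFn hB (fun x => |x|) - B).PosSemidef := by
    have := specFn_posSemidef hB (f := fun x => |x| - x) fun i => sub_nonneg.2 (le_abs_self _)
    rwa [← specFn_sub, specFn_id] at this
  have h₄ : (specFn hB (fun x => |x|) + B).PosSemidef := by
    have := specFn_posSemidef hB (f := fun x => |x| + x)
      fun i => by linarith [neg_abs_le (hB.eigenvalues i)]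
    rwa [← specFn_add, specFn_id] at this
  refine (trace_mul_re_le_of_dominated h₁ h₂ h₃ h₄).trans_eq ?_
  rw [smul_mul_assoc, one_mul, Matrix.trace_smul, specFn_trace, traceNorm_eq_sum_abs hB,
    smul_eq_mul, ← Complex.ofReal_mul, Complex.ofReal_re]

lemma trace_re_le_traceNorm {B : Matrix n n ℂ} (hB : B.IsHermitian) :
    (B.trace).re ≤ traceNorm B := by
  rw [traceNorm_eq_sum_abs hB]
  conv_lhs => rw [← specFn_id hB]
  rw [specFn_trace, Complex.ofReal_re]
  exact Finset.sum_le_sum fun i _ => le_abs_self _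

section PartialTranspose

variable {α β : Type*}

lemma ptB_isHermitian {X : Matrix (α × β) (α × β) ℂ} (hX : X.IsHermitian) :
    (ptB X).IsHermitian :=
  Matrix.IsHermitian.ext fun p q => hX.apply (p.1, q.2) (q.1, p.2)

variable [Fintype α] [Fintype β]

lemma ptB_trace (X : Matrix (α × β) (α × β) ℂ) : (ptB X).trace = X.trace := rfl

lemma trace_mul_ptB (X Y : Matrix (α × β) (α × β) ℂ) :
    (ptB X * ptB Y).trace = (X * Y).trace := by
  simp only [Matrix.trace, Matrix.diag_apply, Matrix.mul_apply, ptB, Matrix.of_apply,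
    Fintype.sum_prod_type]
  refine Finset.sum_congr rfl fun a _ => ?_
  rw [Finset.sum_comm]
  conv_rhs => rw [Finset.sum_comm]
  refine Finset.sum_congr rfl fun a' _ => Finset.sum_comm

variable [DecidableEq α] [DecidableEq β]

/-- Every step of the `PPT_k` hierarchy is bounded in trace norm by the next one. -/
lemma traceNorm_ptB_le_of_dominated {X Y : Matrix (α × β) (α × β) ℂ} (hX : X.IsHermitian)
    (hY : Y.IsHermitian) (h₁ : (Y - ptB X).PosSemidef) (h₂ : (Y + ptB X).PosSemidef) :
    traceNorm (ptB X) ≤ traceNorm (ptB Y) :=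
  (traceNorm_le_trace (ptB_isHermitian hX) h₁ h₂).trans
    (ptB_trace Y ▸ trace_re_le_traceNorm (ptB_isHermitian hY))

lemma memPPTk.exists_dominating {k : ℕ} (hk : 2 ≤ k) {σ : Matrix (α × β) (α × β) ℂ}
    (hσ : memPPTk k σ) :
    traceNorm (ptB σ) ≤ 1 ∧ ∃ W : Matrix (α × β) (α × β) ℂ, W.IsHermitian ∧
      (W - ptB σ).PosSemidef ∧ (W + ptB σ).PosSemidef ∧ traceNorm (ptB W) ≤ 1 := by
  obtain ⟨-, ω, rfl, hherm, hdom, hk1⟩ := hσ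
  have hchain : ∀ j ≤ k - 1, traceNorm (ptB (ω (k - j))) ≤ 1 := by
    intro j hj
    induction j with
    | zero => exact hk1
    | succ j ih =>
      have hd := hdom (k - (j + 1)) (Finset.mem_Icc.2 ⟨by omega, by omega⟩)
      have he : k - (j + 1) + 1 = k - j := by omega
      rw [he] at hd
      exact (traceNorm_ptB_le_of_dominated (hherm _ (Finset.mem_Icc.2 ⟨by omega, by omega⟩))
        (hherm _ (Finset.mem_Icc.2 ⟨by omega, by omega⟩)) hd.1 hd.2).trans (ih (by omega))
  have h1 := hchain (k - 1) le_rfl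
  have h2 := hchain (k - 2) (by omega)
  rw [show k - (k - 1) = 1 by omega] at h1
  rw [show k - (k - 2) = 2 by omega] at h2
  have hd := hdom 1 (Finset.mem_Icc.2 ⟨le_rfl, by omega⟩)
  exact ⟨h1, ω 2, hherm 2 (Finset.mem_Icc.2 ⟨by omega, hk⟩), hd.1, hd.2, h2⟩

end PartialTranspose

/-- Every Hermitian matrix is dominated by some `Y`, in the sense `-Y ≤ A ≤ Y`. -/
lemma exists_dominating {A : Matrix n n ℂ} (hA : A.IsHermitian) :
    ∃ Y : Matrix n n ℂ, Y.IsHermitian ∧ (A + Y).PosSemidef ∧ (Y - A).PosSemidef := by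
  refine ⟨specFn hA (fun x => |x|), (specFn_posSemidef hA fun i => abs_nonneg _).1, ?_, ?_⟩
  · have := specFn_posSemidef hA (f := fun x => x + |x|)
      fun i => by linarith [neg_abs_le (hA.eigenvalues i)]
    rwa [← specFn_add, specFn_id] at this
  · have := specFn_posSemidef hA (f := fun x => |x| - x) fun i => sub_nonneg.2 (le_abs_self _)
    rwa [← specFn_sub, specFn_id] at this

lemma suppProj_eq_specFn {A : Matrix n n ℂ} (hA : A.IsHermitian) :
    suppProj A = specFn hA (fun x => if x = 0 then 0 else 1) := by
  simp [suppProj, specFn, hA, apply_ite Complex.ofReal]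

lemma suppProj_posSemidef {A : Matrix n n ℂ} (hA : A.IsHermitian) : (suppProj A).PosSemidef := by
  rw [suppProj_eq_specFn hA]
  exact specFn_posSemidef hA fun i => by split_ifs <;> norm_num

lemma one_sub_suppProj_posSemidef {A : Matrix n n ℂ} (hA : A.IsHermitian) :
    (1 - suppProj A).PosSemidef := by
  have h := specFn_const hA 1
  rw [Complex.ofReal_one, one_smul] at h
  rw [suppProj_eq_specFn hA, ← h, specFn_sub]
  exact specFn_posSemidef hA fun i => by split_ifs <;> norm_num

lemma suppProj_mul_self {A : Matrix n n ℂ} (hA : A.IsHermitian) : suppProj A * A = A := by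
  conv_lhs => rw [suppProj_eq_specFn hA]
  nth_rw 2 [← specFn_id hA]
  rw [specFn_mul]
  conv_rhs => rw [← specFn_id hA]
  congr 1
  funext x
  by_cases hx : x = 0 <;> simp [hx]

/-- The two-outcome measurement `{Π_ρ, 1 - Π_ρ}` bounds the measured relative entropy below. -/
lemma klTerm_suppProj_le_measRelEnt {ρ : Matrix n n ℂ} (hρ : ρ.IsHermitian) (hρ1 : ρ.trace = 1)
    (σ : Matrix n n ℂ) :
    klTerm 1 ((suppProj ρ * σ).trace).re ≤ measRelEnt ρ σ := by
  have hM : IsPOVM ![suppProj ρ, 1 - suppProj ρ] := by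
    refine ⟨fun x => ?_, by simp⟩
    fin_cases x
    · exact suppProj_posSemidef hρ
    · exact one_sub_suppProj_posSemidef hρ
  refine le_trans (le_of_eq ?_) (le_iSup_of_le 2 (le_iSup₂_of_le _ hM le_rfl))
  simp [sub_mul, suppProj_mul_self hρ, hρ1, klTerm]

/-- `max{E_{WD,1}(ρ), E_{WD,2}(ρ)} ≤ D_M(ρ‖PPT_k(A:B))`. -/
theorem EWD_le_measRelEnt_pptk {dA dB : ℕ} (k : ℕ) (hk : 2 ≤ k)
    (ρ : Matrix (Fin dA × Fin dB) (Fin dA × Fin dB) ℂ)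
    (hρ : ρ.PosSemidef) (hρ1 : ρ.trace = 1) :
    ((max
        (-Real.logb 2 (sSup {r : ℝ | ∃ V : Matrix (Fin dA × Fin dB) (Fin dA × Fin dB) ℂ,
          V.PosSemidef ∧ traceNorm (ptB V) ≤ 1 ∧ r = ((suppProj ρ * V).trace).re}))
        (-Real.logb 2 (sInf {r : ℝ | ∃ Y : Matrix (Fin dA × Fin dB) (Fin dA × Fin dB) ℂ,
          Y.IsHermitian ∧ (ptB (suppProj ρ) + Y).PosSemidef ∧
          (Y - ptB (suppProj ρ)).PosSemidef ∧ r = opNorm (ptB Y)})) : ℝ) : EReal) ≤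
      ⨅ (σ : Matrix (Fin dA × Fin dB) (Fin dA × Fin dB) ℂ) (_ : memPPTk k σ),
        measRelEnt ρ σ := by
  refine le_iInf₂ fun σ hσ => (?_ : _ ≤ _).trans (klTerm_suppProj_le_measRelEnt hρ.1 hρ1 σ)
  have ht0 : 0 ≤ ((suppProj ρ * σ).trace).re :=
    trace_mul_re_nonneg (suppProj_posSemidef hρ.1) hσ.1
  obtain ⟨hσ1, W, hW, hW₁, hW₂, hWn⟩ := hσ.exists_dominating hk
  rcases ht0.eq_or_lt with ht | ht
  · simp [klTerm, ← ht]
  rw [klTerm, if_neg one_ne_zero, if_neg ht.ne', EReal.coe_le_coe_iff, one_mul, one_div,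
    Real.logb_inv]
  refine max_le (neg_le_neg (Real.logb_le_logb_of_le one_lt_two ht ?_))
    (neg_le_neg (Real.logb_le_logb_of_le one_lt_two ht ?_))
  · refine le_csSup ⟨opNorm (ptB (suppProj ρ)), ?_⟩ ⟨σ, hσ.1, hσ1, rfl⟩
    rintro r ⟨V, hV, hV1, rfl⟩
    rw [← trace_mul_ptB]
    exact (trace_mul_re_le_opNorm_mul_traceNorm (ptB_isHermitian (suppProj_posSemidef hρ.1).1)
      (ptB_isHermitian hV.1)).trans (mul_le_of_le_one_right (opNorm_nonneg _) hV1)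
  · refine le_csInf ?_ ?_
    · obtain ⟨Y, hY, hY₁, hY₂⟩ :=
        exists_dominating (ptB_isHermitian (suppProj_posSemidef hρ.1).1)
      exact ⟨_, Y, hY, hY₁, hY₂, rfl⟩
    · rintro r ⟨Y, hY, hY₁, hY₂, rfl⟩
      rw [← trace_mul_ptB]
      refine (trace_mul_re_le_of_dominated hY₂ (add_comm (ptB (suppProj ρ)) Y ▸ hY₁)
        hW₁ hW₂).trans ?_
      rw [← trace_mul_ptB]
      exact (trace_mul_re_le_opNorm_mul_traceNorm (ptB_isHermitian hY)
        (ptB_isHermitian hW)).trans (mul_le_of_le_one_right (opNorm_nonneg _) hWn)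

end QIT
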